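/- arXiv:1905.03505 — 3 statements merged into one kernel-verified Lean document; each statement's English description precedes it below -/
import Mathlib

section
/- Sure success of the Jacobian test: Let B ⊆ ℝⁿ be a box of width w > 0, let f : ℝⁿ → ℝⁿ be twice continuously differentiable, and let α ∈ B be a simple zero of f. Set U := max_{i,j} |∂f_i/∂x_j(α)| and V := max_{i,j} K(3B)_{ij}, and for each i, j let R_{ij} := [min_{x∈3B} ∂f_i/∂x_j(x), max_{x∈3B} ∂f_i/∂x_j(x)]. If 3·n·n!·V·(U + 3Vw)^{n−1}·w < |det J(α)|, then every n×n real matrix M with M_{ij} ∈ R_{ij} for all i, j satisfies det M ≠ 0 (i.e., the Jacobian test JC(B) succeeds). -/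
/-- The partial derivative `∂f_i/∂x_j` at `x`. -/
noncomputable def pd (n : ℕ) (f : (Fin n → ℝ) → (Fin n → ℝ)) (i j : Fin n)
    (x : Fin n → ℝ) : ℝ :=
  fderiv ℝ (fun y => f y i) x (Pi.single j 1)

/-- The Jacobian matrix of `f` at `x`. -/
noncomputable def Jmat (n : ℕ) (f : (Fin n → ℝ) → (Fin n → ℝ))
    (x : Fin n → ℝ) : Matrix (Fin n) (Fin n) ℝ :=
  fun i j => pd n f i j x

/-- The matrix `K(C)` with entries `K(C)_{ij} = Σ_k sup_{x∈C} |∂²f_i/(∂x_j∂x_k)(x)|`. -/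
noncomputable def Kmat (n : ℕ) (f : (Fin n → ℝ) → (Fin n → ℝ))
    (C : Set (Fin n → ℝ)) : Matrix (Fin n) (Fin n) ℝ :=
  fun i j => ∑ k, sSup ((fun x => |fderiv ℝ (pd n f i j) x (Pi.single k 1)|) '' C)

/-- The box of width `w` centered at `c`. -/
def box (n : ℕ) (c : Fin n → ℝ) (w : ℝ) : Set (Fin n → ℝ) :=
  Set.Icc (fun i => c i - w / 2) (fun i => c i + w / 2)

theorem abs_prod_sub_prod_le {ι : Type*} (s : Finset ι) (a b : ι → ℝ) {C d : ℝ}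
    (ha : ∀ i ∈ s, |a i| ≤ C) (hb : ∀ i ∈ s, |b i| ≤ C) (hd : ∀ i ∈ s, |a i - b i| ≤ d) :
    |∏ i ∈ s, a i - ∏ i ∈ s, b i| ≤ s.card * C ^ (s.card - 1) * d := by
  classical
  induction s using Finset.induction_on with
  | empty => simp
  | insert i s hi ih =>
    simp only [Finset.forall_mem_insert] at ha hb hd
    have hC : 0 ≤ C := (abs_nonneg _).trans ha.1
    have hprod : |∏ j ∈ s, b j| ≤ C ^ s.card := by
      rw [Finset.abs_prod]
      exact (Finset.prod_le_prod (fun _ _ => abs_nonneg _) hb.2).trans_eq (Finset.prod_const C)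
    rw [Finset.prod_insert hi, Finset.prod_insert hi, Finset.card_insert_of_notMem hi]
    have hpow : (s.card : ℝ) * (C * C ^ (s.card - 1)) = s.card * C ^ s.card := by
      rcases Nat.eq_zero_or_pos s.card with h | h
      · simp [h]
      · rw [mul_pow_sub_one h.ne']
    calc |a i * ∏ j ∈ s, a j - b i * ∏ j ∈ s, b j|
        = |a i * (∏ j ∈ s, a j - ∏ j ∈ s, b j) + (a i - b i) * ∏ j ∈ s, b j| := by ring_nf
      _ ≤ |a i| * |∏ j ∈ s, a j - ∏ j ∈ s, b j| + |a i - b i| * |∏ j ∈ s, b j| := by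
        rw [← abs_mul, ← abs_mul]
        exact abs_add_le _ _
      _ ≤ C * (s.card * C ^ (s.card - 1) * d) + d * C ^ s.card :=
        add_le_add (mul_le_mul ha.1 (ih ha.2 hb.2 hd.2) (abs_nonneg _) hC)
          (mul_le_mul hd.1 hprod (abs_nonneg _) ((abs_nonneg _).trans hd.1))
      _ = _ := by
        simp only [Nat.add_sub_cancel]
        push_cast
        linear_combination d * hpow

theorem abs_det_sub_det_le {ι : Type*} [Fintype ι] [DecidableEq ι] (A B : Matrix ι ι ℝ) {C d : ℝ}
    (hA : ∀ i j, |A i j| ≤ C) (hB : ∀ i j, |B i j| ≤ C) (hd : ∀ i j, |A i j - B i j| ≤ d) :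
    |A.det - B.det| ≤
      (Fintype.card ι).factorial * (Fintype.card ι * C ^ (Fintype.card ι - 1) * d) := by
  rw [Matrix.det_apply', Matrix.det_apply', ← Finset.sum_sub_distrib]
  calc _ ≤ ∑ σ : Equiv.Perm ι, |_| := Finset.abs_sum_le_sum_abs _ _
    _ ≤ ∑ _σ : Equiv.Perm ι, (Fintype.card ι * C ^ (Fintype.card ι - 1) * d) := by
      refine Finset.sum_le_sum fun σ _ => ?_
      rw [← mul_sub, abs_mul, ← Int.cast_abs, Int.isUnit_iff_abs_eq.1 (Equiv.Perm.sign σ).isUnit,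
        Int.cast_one, one_mul]
      exact abs_prod_sub_prod_le Finset.univ _ _ (fun i _ => hA _ i) (fun i _ => hB _ i)
        fun i _ => hd _ i
    _ = _ := by simp [Fintype.card_perm]

theorem contDiff_pd {n : ℕ} {f : (Fin n → ℝ) → (Fin n → ℝ)} (hf : ContDiff ℝ 2 f) (i j : Fin n) :
    ContDiff ℝ 1 (pd n f i j) :=
  ((contDiff_pi.1 hf i).fderiv_right (m := 1) (by norm_num)).clm_apply contDiff_const

theorem le_sSup_abs_fderiv_pd {n : ℕ} {f : (Fin n → ℝ) → (Fin n → ℝ)} (hf : ContDiff ℝ 2 f)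
    (c : Fin n → ℝ) (w : ℝ) (i j k : Fin n) {x : Fin n → ℝ} (hx : x ∈ box n c w) :
    |fderiv ℝ (pd n f i j) x (Pi.single k 1)| ≤
      sSup ((fun x => |fderiv ℝ (pd n f i j) x (Pi.single k 1)|) '' box n c w) := by
  have hcont : Continuous fun x => |fderiv ℝ (pd n f i j) x (Pi.single k 1)| :=
    (((contDiff_pd hf i j).continuous_fderiv one_ne_zero).clm_apply continuous_const).abs
  have hbox : IsCompact (box n c w) := isCompact_Icc
  exact le_csSup (hbox.image hcont).bddAbove (Set.mem_image_of_mem _ hx)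

theorem Kmat_nonneg (n : ℕ) (f : (Fin n → ℝ) → (Fin n → ℝ)) (C : Set (Fin n → ℝ)) (i j : Fin n) :
    0 ≤ Kmat n f C i j :=
  Finset.sum_nonneg fun _ _ => Real.sSup_nonneg <| by
    rintro _ ⟨x, _, rfl⟩
    exact abs_nonneg _

theorem norm_fderiv_pd_le_Kmat {n : ℕ} {f : (Fin n → ℝ) → (Fin n → ℝ)} (hf : ContDiff ℝ 2 f)
    (c : Fin n → ℝ) (w : ℝ) (i j : Fin n) {x : Fin n → ℝ} (hx : x ∈ box n c w) :
    ‖fderiv ℝ (pd n f i j) x‖ ≤ Kmat n f (box n c w) i j := by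
  refine ContinuousLinearMap.opNorm_le_bound _ (Kmat_nonneg ..) fun v => ?_
  have hv : fderiv ℝ (pd n f i j) x v = ∑ k, v k * fderiv ℝ (pd n f i j) x (Pi.single k 1) := by
    conv_lhs => rw [pi_eq_sum_univ' v]
    simp [map_sum]
  rw [hv, Kmat, Finset.sum_mul]
  refine (norm_sum_le _ _).trans (Finset.sum_le_sum fun k _ => ?_)
  rw [norm_mul, mul_comm]
  exact mul_le_mul (le_sSup_abs_fderiv_pd hf c w i j k hx) (norm_le_pi_norm v k) (norm_nonneg _)
    ((abs_nonneg _).trans (le_sSup_abs_fderiv_pd hf c w i j k hx))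

theorem abs_pd_sub_pd_le {n : ℕ} {f : (Fin n → ℝ) → (Fin n → ℝ)} (hf : ContDiff ℝ 2 f)
    (c : Fin n → ℝ) (w : ℝ) (i j : Fin n) {x y : Fin n → ℝ} (hx : x ∈ box n c w)
    (hy : y ∈ box n c w) :
    |pd n f i j y - pd n f i j x| ≤ Kmat n f (box n c w) i j * ‖y - x‖ :=
  (convex_Icc _ _).norm_image_sub_le_of_norm_fderiv_le
    (fun z _ => ((contDiff_pd hf i j).differentiable one_ne_zero) z)
    (fun _ hz => norm_fderiv_pd_le_Kmat hf c w i j hz) hx hy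

theorem le_iSup_iSup_fin {m n : ℕ} (g : Fin m → Fin n → ℝ) (i : Fin m) (j : Fin n) :
    g i j ≤ ⨆ i, ⨆ j, g i j :=
  (le_ciSup (Set.finite_range (g i)).bddAbove j).trans
    (le_ciSup (f := fun i => ⨆ j, g i j) (Set.finite_range _).bddAbove i)


/-- **Sure success of the Jacobian test.** Let `α ∈ B` be a simple zero of the
`C²` map `f`.  With `U = max_{i,j} |∂f_i/∂x_j(α)|`, `V = max_{i,j} K(3B)_{ij}`
and `R_{ij} = [min_{x∈3B} ∂f_i/∂x_j(x), max_{x∈3B} ∂f_i/∂x_j(x)]`, if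
`3·n·n!·V·(U + 3Vw)^{n−1}·w < |det J(α)|` then every matrix with entries in
the `R_{ij}` has nonzero determinant. -/
theorem jacobian_test_sure_success (n : ℕ) (c : Fin n → ℝ) (w : ℝ) (hw : 0 < w)
    (f : (Fin n → ℝ) → (Fin n → ℝ)) (hf : ContDiff ℝ 2 f)
    (α : Fin n → ℝ) (hα : α ∈ box n c w)
    (hroot : f α = 0) (hsimple : IsUnit (Jmat n f α))
    (U V : ℝ)
    (hU : U = ⨆ i : Fin n, ⨆ j : Fin n, |pd n f i j α|)
    (hV : V = ⨆ i : Fin n, ⨆ j : Fin n, Kmat n f (box n c (3 * w)) i j)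
    (hsmall : 3 * n * (Nat.factorial n : ℝ) * V * (U + 3 * V * w) ^ (n - 1) * w
      < |(Jmat n f α).det|) :
    ∀ M : Matrix (Fin n) (Fin n) ℝ,
      (∀ i j : Fin n, M i j ∈ Set.Icc
        (sInf ((fun x => pd n f i j x) '' box n c (3 * w)))
        (sSup ((fun x => pd n f i j x) '' box n c (3 * w)))) →
      M.det ≠ 0 := by
  intro M hM hdet
  have hV0 : 0 ≤ V := hV ▸ Real.iSup_nonneg fun i => Real.iSup_nonneg fun j => Kmat_nonneg ..
  have hα3 : α ∈ box n c (3 * w) :=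
    ⟨fun i => by linarith [hα.1 i], fun i => by linarith [hα.2 i]⟩
  have hclose : ∀ i j, ∀ x ∈ box n c (3 * w), |pd n f i j x - pd n f i j α| ≤ 3 * V * w := by
    intro i j x hx
    have hnorm : ‖x - α‖ ≤ 3 * w := by
      refine (pi_norm_le_iff_of_nonneg (by positivity)).2 fun k => abs_le.2 ⟨?_, ?_⟩
      · linarith [hx.1 k, hα3.2 k, Pi.sub_apply x α k]
      · linarith [hx.2 k, hα3.1 k, Pi.sub_apply x α k]
    calc _ ≤ _ := abs_pd_sub_pd_le hf c (3 * w) i j hα3 hx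
      _ ≤ V * (3 * w) := mul_le_mul (hV ▸ le_iSup_iSup_fin _ i j) hnorm (norm_nonneg _) hV0
      _ = 3 * V * w := by ring
  have hMJ : ∀ i j, |Jmat n f α i j - M i j| ≤ 3 * V * w := by
    intro i j
    have hne : ((fun x => pd n f i j x) '' box n c (3 * w)).Nonempty :=
      ⟨_, Set.mem_image_of_mem _ hα3⟩
    have hlow : pd n f i j α - 3 * V * w ≤ M i j := by
      refine (le_csInf hne ?_).trans (hM i j).1
      rintro _ ⟨x, hx, rfl⟩
      linarith [(abs_le.1 (hclose i j x hx)).1]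
    have hupp : M i j ≤ pd n f i j α + 3 * V * w := by
      refine (hM i j).2.trans (csSup_le hne ?_)
      rintro _ ⟨x, hx, rfl⟩
      linarith [(abs_le.1 (hclose i j x hx)).2]
    exact abs_le.2 ⟨by linarith [show Jmat n f α i j = pd n f i j α from rfl],
      by linarith [show Jmat n f α i j = pd n f i j α from rfl]⟩
  have hJ : ∀ i j, |Jmat n f α i j| ≤ U := fun i j =>
    hU ▸ le_iSup_iSup_fin (fun i j => |pd n f i j α|) i j
  have hVw : 0 ≤ 3 * V * w := by positivity
  have hdiff := abs_det_sub_det_le (Jmat n f α) M (C := U + 3 * V * w)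
    (fun i j => (hJ i j).trans (by linarith))
    (fun i j => by
      have h := abs_sub_abs_le_abs_sub (M i j) (Jmat n f α i j)
      rw [abs_sub_comm] at h
      linarith [hJ i j, hMJ i j]) hMJ
  rw [hdet, sub_zero, Fintype.card_fin] at hdiff
  linarith
end

section
/- Sure success of the exclusion test C₀ away from the roots (Lemma B, far case): Let f = (f₁,…,f_n) : ℝⁿ → ℝⁿ be continuous, with each zero set S_i := {x : f_i(x) = 0} nonempty. Let B₀ ⊆ ℝⁿ be a box, let Z denote the set of zeros of f in 2B₀, let ℓ₁ > 0, and define R₀ := 2B₀ \ ⋃_{α∈Z} U(α, ℓ₁), where U(α, ℓ₁) is the open Euclidean ball of radius ℓ₁ centered at α. Define d₀ := inf_{p∈R₀} max_{1≤i≤n} dist(p, S_i) (Euclidean distances). Let B ⊆ 2B₀ be a box of width w > 0 with center m_B such that dist(m_B, α) ≥ ℓ₁ for every α ∈ Z. If w ≤ d₀/(2√n), then there exists i ∈ {1,…,n} such that f_i(x) ≠ 0 for all x ∈ B (i.e., the exclusion test C₀(B) succeeds). -/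
/-- The Euclidean distance on `Fin n → ℝ`. -/
noncomputable def eudist (n : ℕ) (x y : Fin n → ℝ) : ℝ :=
  Real.sqrt (∑ i, (x i - y i) ^ 2)

/-- The Euclidean distance from a point to a set. -/
noncomputable def euInfDist (n : ℕ) (p : Fin n → ℝ) (S : Set (Fin n → ℝ)) : ℝ :=
  sInf ((fun s => eudist n p s) '' S)

theorem eudist_nonneg (n : ℕ) (x y : Fin n → ℝ) : 0 ≤ eudist n x y :=
  Real.sqrt_nonneg _

theorem euInfDist_nonneg (n : ℕ) (p : Fin n → ℝ) (S : Set (Fin n → ℝ)) :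
    0 ≤ euInfDist n p S := by
  apply Real.sInf_nonneg
  rintro _ ⟨s, -, rfl⟩
  exact eudist_nonneg n p s

theorem euInfDist_le_eudist (n : ℕ) (p : Fin n → ℝ) {S : Set (Fin n → ℝ)} {s : Fin n → ℝ}
    (hs : s ∈ S) : euInfDist n p S ≤ eudist n p s := by
  refine csInf_le ⟨0, ?_⟩ ⟨s, hs, rfl⟩
  rintro _ ⟨t, -, rfl⟩
  exact eudist_nonneg n p t

theorem center_mem_box (n : ℕ) (c : Fin n → ℝ) {w : ℝ} (hw : 0 ≤ w) : c ∈ box n c w :=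
  ⟨fun i => by dsimp only; linarith, fun i => by dsimp only; linarith⟩

theorem eudist_center_le_of_mem_box (n : ℕ) {c x : Fin n → ℝ} {w : ℝ} (hw : 0 ≤ w)
    (hx : x ∈ box n c w) : eudist n c x ≤ Real.sqrt n * (w / 2) := by
  apply Real.sqrt_le_iff.mpr
  refine ⟨by positivity, ?_⟩
  rw [mul_pow, Real.sq_sqrt n.cast_nonneg]
  calc ∑ i, (c i - x i) ^ 2 ≤ ∑ _i : Fin n, (w / 2) ^ 2 := by
        refine Finset.sum_le_sum fun i _ => sq_le_sq' ?_ ?_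
        · have := hx.2 i
          dsimp only at this
          linarith
        · have := hx.1 i
          dsimp only at this
          linarith
    _ = n * (w / 2) ^ 2 := by simp

/-- **Sure success of the exclusion test `C₀` away from the roots (Lemma B,
far case).** Let `Z` be the zero set of `f` in `2B₀`,
`R₀ = 2B₀ \ ⋃_{α∈Z} U(α, ℓ₁)`, and
`d₀ = inf_{p∈R₀} max_i dist(p, S_i)` where `S_i` is the zero set of `f_i`.
If `B ⊆ 2B₀` is a box of width `w` whose center is at Euclidean distance at
least `ℓ₁` from every root in `Z`, and `w ≤ d₀/(2√n)`, then some `f_i` is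
nonvanishing on `B`. -/
theorem exclusion_test_sure_success (n : ℕ)
    (f : (Fin n → ℝ) → (Fin n → ℝ)) (hf : Continuous f)
    (hSne : ∀ i : Fin n, {x : Fin n → ℝ | f x i = 0}.Nonempty)
    (c₀ : Fin n → ℝ) (w₀ : ℝ) (hw₀ : 0 < w₀)
    (Z : Set (Fin n → ℝ)) (hZ : Z = {x ∈ box n c₀ (2 * w₀) | f x = 0})
    (l₁ : ℝ) (hl₁ : 0 < l₁)
    (R₀ : Set (Fin n → ℝ))
    (hR₀ : R₀ = box n c₀ (2 * w₀) \ ⋃ α ∈ Z, {x | eudist n x α < l₁})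
    (d₀ : ℝ)
    (hd₀ : d₀ = sInf ((fun p => ⨆ i : Fin n,
      euInfDist n p {x | f x i = 0}) '' R₀))
    (cB : Fin n → ℝ) (w : ℝ) (hw : 0 < w)
    (hBsub : box n cB w ⊆ box n c₀ (2 * w₀))
    (hfar : ∀ α ∈ Z, l₁ ≤ eudist n cB α)
    (hwsmall : w ≤ d₀ / (2 * Real.sqrt n)) :
    ∃ i : Fin n, ∀ x ∈ box n cB w, f x i ≠ 0 := by
  have hn : n ≠ 0 := by
    rintro rfl
    simp at hwsmall
    linarith
  have : Nonempty (Fin n) := ⟨⟨0, Nat.pos_of_ne_zero hn⟩⟩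
  have hsqrt : 0 < Real.sqrt n := Real.sqrt_pos.mpr (by exact_mod_cast Nat.pos_of_ne_zero hn)
  have hcB : cB ∈ R₀ := by
    rw [hR₀]
    refine ⟨hBsub (center_mem_box n cB hw.le), ?_⟩
    simp only [Set.mem_iUnion, Set.mem_ofPred_eq, not_exists, not_lt]
    exact hfar
  have hd₀_le : d₀ ≤ ⨆ i : Fin n, euInfDist n cB {x | f x i = 0} := by
    rw [hd₀]
    refine csInf_le ⟨0, ?_⟩ ⟨cB, hcB, rfl⟩
    rintro _ ⟨p, -, rfl⟩
    exact Real.iSup_nonneg fun i => euInfDist_nonneg n p _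
  obtain ⟨i, hi⟩ := exists_eq_ciSup_of_finite
    (f := fun i : Fin n => euInfDist n cB {x | f x i = 0})
  refine ⟨i, fun x hx hfx => ?_⟩
  have hdist : d₀ ≤ Real.sqrt n * (w / 2) :=
    hd₀_le.trans <| hi.symm.trans_le <|
      (euInfDist_le_eudist n cB (S := {x | f x i = 0}) hfx).trans <|
        eudist_center_le_of_mem_box n hw.le hx
  rw [le_div_iff₀ (by positivity)] at hwsmall
  nlinarith [mul_pos hsqrt hw]
end

section
/- Sure success of the interval exclusion test (Lemma □B): Let f = (f₁,…,f_n) : ℝⁿ → ℝⁿ be continuous, let B₀ ⊆ ℝⁿ be a box, let Z denote the set of zeros of f in 2B₀, let ℓ₁' > 0, and define R₀' := 2B₀ \ ⋃_{α∈Z} U(α, ℓ₁'), where U(α, ℓ₁') is the open Euclidean ball of radius ℓ₁' centered at α. Let L̂ > 0 and define u := inf_{p∈R₀'} max_{1≤i≤n} |f_i(p)| / L̂. Let B ⊆ 2B₀ be a box of width w > 0 with center m_B such that dist(m_B, α) ≥ ℓ₁' for every α ∈ Z, and suppose w ≤ u/2. For each i ∈ {1,…,n} let I_i be a nonempty compact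 interval with {f_i(x) : x ∈ B} ⊆ I_i and w(I_i) ≤ L̂·w. Then there exists j ∈ {1,…,n} such that 0 ∉ I_j (i.e., the interval exclusion test succeeds on B). -/
/-- **Sure success of the interval exclusion test (Lemma □B).** Let `Z` be the
zero set of `f` in `2B₀`, `R₀' = 2B₀ \ ⋃_{α∈Z} U(α, ℓ₁')`, `L̂ > 0` and
`u = inf_{p∈R₀'} max_i |f_i(p)|/L̂`.  Let `B ⊆ 2B₀` be a box of width
`w ≤ u/2` whose center is at Euclidean distance at least `ℓ₁'` from every root
in `Z`.  If each interval `I_i = [iA i, iB i]` encloses the range of `f_i` over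
`B` and has width at most `L̂·w`, then `0 ∉ I_j` for some `j`. -/
theorem interval_exclusion_sure_success (n : ℕ)
    (f : (Fin n → ℝ) → (Fin n → ℝ)) (hf : Continuous f)
    (c₀ : Fin n → ℝ) (w₀ : ℝ) (hw₀ : 0 < w₀)
    (Z : Set (Fin n → ℝ)) (hZ : Z = {x ∈ box n c₀ (2 * w₀) | f x = 0})
    (l₁ : ℝ) (hl₁ : 0 < l₁)
    (R₀ : Set (Fin n → ℝ))
    (hR₀ : R₀ = box n c₀ (2 * w₀) \ ⋃ α ∈ Z, {x | eudist n x α < l₁})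
    (L : ℝ) (hL : 0 < L)
    (u : ℝ) (hu : u = sInf ((fun p => ⨆ i : Fin n, |f p i| / L) '' R₀))
    (cB : Fin n → ℝ) (w : ℝ) (hw : 0 < w)
    (hBsub : box n cB w ⊆ box n c₀ (2 * w₀))
    (hfar : ∀ α ∈ Z, l₁ ≤ eudist n cB α)
    (hwsmall : w ≤ u / 2)
    (iA iB : Fin n → ℝ) (hI : ∀ i, iA i ≤ iB i)
    (hImem : ∀ i : Fin n, ∀ x ∈ box n cB w, f x i ∈ Set.Icc (iA i) (iB i))
    (hIw : ∀ i, iB i - iA i ≤ L * w) :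
    ∃ j : Fin n, (0 : ℝ) ∉ Set.Icc (iA j) (iB j) := by
  by_contra! h
  have hc : cB ∈ box n cB w :=
    ⟨fun i => by dsimp only; linarith, fun i => by dsimp only; linarith⟩
  have hcR : cB ∈ R₀ := by
    rw [hR₀]
    refine ⟨hBsub hc, ?_⟩
    simp only [Set.mem_iUnion, Set.mem_ofPred_eq, not_exists, not_lt]
    exact hfar
  have hle : u ≤ ⨆ i : Fin n, |f cB i| / L := by
    rw [hu]
    refine csInf_le ⟨0, ?_⟩ ⟨cB, hcR, rfl⟩
    rintro _ ⟨p, -, rfl⟩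
    exact Real.iSup_nonneg fun i => by positivity
  have hsup : ⨆ i : Fin n, |f cB i| / L ≤ w := by
    refine Real.iSup_le (fun i => ?_) hw.le
    rw [div_le_iff₀ hL, abs_le]
    have hm := hImem i cB hc
    have h0 := h i
    have hwi := hIw i
    constructor <;> linarith [hm.1, hm.2, h0.1, h0.2]
  linarith
end
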